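/- For n ≤ -2 and 0 ≤ m ≤ -n-2, the L² inner product on B^e = {|x| > 1} satisfies ⟨X̄_{n,m}^{+}, X_{n,m}^{+}⟩ = 2π(n − 2m² + 1)(1 + δ_{0,m})(−(n−m+2))! / ((2n+3)(2n+1)(−(n+m+2))!). -/

import Mathlib

open MeasureTheory Real

noncomputable section

/-- Euclidean space `ℝ³` with coordinates `x 0, x 1, x 2`. -/
abbrev E3 := EuclideanSpace ℝ (Fin 3)

/-- Legendre polynomial of degree `n` via Rodrigues' formula. -/
def legendreP (n : ℕ) (t : ℝ) : ℝ :=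
  (1 / (2 ^ n * n.factorial : ℝ)) * iteratedDeriv n (fun s : ℝ => (s ^ 2 - 1) ^ n) t

/-- Associated Legendre function of nonnegative integer degree `n` and order `m`
(Ferrers-type definition, no Condon–Shortley phase):
`P_n^m(t) = (1-t²)^{m/2} (d/dt)^m P_n(t)`. -/
def assocLegendreNat (n m : ℕ) (t : ℝ) : ℝ :=
  (1 - t ^ 2) ^ ((m : ℝ) / 2) * iteratedDeriv m (legendreP n) t

/-- Associated Legendre function of arbitrary integer degree, using the
reflection `P_{-n}^m = P_{n-1}^m` for negative degrees. -/
def assocLegendre (n : ℤ) (m : ℕ) (t : ℝ) : ℝ :=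
  if 0 ≤ n then assocLegendreNat n.toNat m t else assocLegendreNat (-n - 1).toNat m t

/-- Spherical radius `ρ`. -/
def sphRho (x : E3) : ℝ := Real.sqrt (x 0 ^ 2 + x 1 ^ 2 + x 2 ^ 2)

/-- Azimuthal angle `φ` of the point `(x₁, x₂)`. -/
def sphPhi (x : E3) : ℝ := Complex.arg ⟨x 1, x 2⟩

/-- Azimuthal factor `Φ_m^±(φ)`; `sgn = true` corresponds to `+` (cosine),
`sgn = false` to `−` (sine). -/
def PhiFac (m : ℕ) (sgn : Bool) (φ : ℝ) : ℝ :=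
  if sgn then Real.cos (m * φ) else Real.sin (m * φ)

/-- Solid spherical harmonic `U_{n,m}^{±}(x) = ρ^n P_n^m(cos θ) Φ_m^{±}(φ)`. -/
def solidU (n : ℤ) (m : ℕ) (sgn : Bool) (x : E3) : ℝ :=
  sphRho x ^ n * assocLegendre n m (x 0 / sphRho x) * PhiFac m sgn (sphPhi x)

/-- The exterior `B^e` of the closed unit ball in `ℝ³`. -/
def extB : Set E3 := {x : E3 | 1 < ‖x‖}

/-- The quaternions; the subspace `𝒜 = ℝ + ℝe₁ + ℝe₂` consists of those
quaternions with `imK = 0`. -/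
abbrev H := Quaternion ℝ

def qe1 : H := ⟨0, 1, 0, 0⟩
def qe2 : H := ⟨0, 0, 1, 0⟩

/-- Partial derivative `∂/∂xᵢ` of a quaternion-valued function. -/
def pd (i : Fin 3) (f : E3 → H) (x : E3) : H :=
  fderiv ℝ f x (EuclideanSpace.single i 1)

/-- The Cauchy–Riemann (Fueter) operator `∂̄ = ∂/∂x₀ + e₁∂/∂x₁ + e₂∂/∂x₂`. -/
def Dbar (f : E3 → H) (x : E3) : H := pd 0 f x + qe1 * pd 1 f x + qe2 * pd 2 f x

/-- The conjugate Fueter operator `∂ = ∂/∂x₀ − e₁∂/∂x₁ − e₂∂/∂x₂`. -/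
def Dop (f : E3 → H) (x : E3) : H := pd 0 f x - qe1 * pd 1 f x - qe2 * pd 2 f x

/-- The solid harmonic `U_{n,m}^±` regarded as a quaternion-valued function. -/
def solidUq (n : ℤ) (m : ℕ) (sgn : Bool) (x : E3) : H := ((solidU n m sgn x : ℝ) : H)

/-- The basic spherical monogenic `X_{n,m}^{±} = ∂U_{n+1,m}^{±}`. -/
def Xmon (n : ℤ) (m : ℕ) (sgn : Bool) : E3 → H := Dop (solidUq (n + 1) m sgn)

/-- The scalar inner product on `𝒜`-valued quaternions:
`⟨p,q⟩ = p₀q₀ + p₁q₁ + p₂q₂`. -/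
def qip (p q : H) : ℝ := p.re * q.re + p.imI * q.imI + p.imJ * q.imJ

set_option linter.unusedSimpArgs false

section LegendrePart
open Polynomial

/-- `(X^2-1)^k` differentiated `k+m` times, normalised: the `m`-th derivative of `P_k`. -/
def legQ (k m : ℕ) : ℝ[X] :=
  C (1 / (2 ^ k * k.factorial : ℝ)) * derivative^[k + m] ((X ^ 2 - 1) ^ k)

lemma iteratedDeriv_poly (p : ℝ[X]) (j : ℕ) :
    iteratedDeriv j (fun t => p.eval t) = fun t => (derivative^[j] p).eval t := by
  induction j with
  | zero => simp
  | succ j ih =>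
    rw [iteratedDeriv_succ, ih, Function.iterate_succ_apply']
    funext t
    simp

lemma legendreP_eq (k : ℕ) : legendreP k = fun t => (legQ k 0).eval t := by
  funext t
  have h := iteratedDeriv_poly ((X ^ 2 - 1) ^ k) k
  have h2 : (fun s : ℝ => (s ^ 2 - 1) ^ k) = fun t => ((X ^ 2 - 1 : ℝ[X]) ^ k).eval t := by
    funext t; simp
  simp only [legendreP, legQ]
  rw [h2, h]
  simp only [eval_mul, eval_C, add_zero]

lemma iteratedDeriv_legendreP (k m : ℕ) (t : ℝ) :
    iteratedDeriv m (legendreP k) t = (legQ k m).eval t := by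
  rw [legendreP_eq, iteratedDeriv_poly]
  simp only [legQ, iterate_derivative_C_mul, ← Function.iterate_add_apply, add_zero]
  rw [add_comm m k]

lemma derivative_legQ (k m : ℕ) : derivative (legQ k m) = legQ k (m + 1) := by
  simp only [legQ, derivative_C_mul, ← Function.iterate_succ_apply' derivative]
  rfl

lemma rodrigues_ode (k j : ℕ) :
    (X ^ 2 - 1 : ℝ[X]) * derivative^[j + 2] ((X ^ 2 - 1) ^ k) =
      C (2 * ((k : ℝ) - j - 1)) * X * derivative^[j + 1] ((X ^ 2 - 1) ^ k) +
      C (((j : ℝ) + 1) * (2 * k - j)) * derivative^[j] ((X ^ 2 - 1) ^ k) := by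
  induction j with
  | zero =>
    have h1 : (X ^ 2 - 1 : ℝ[X]) * derivative ((X ^ 2 - 1) ^ k) =
        C (2 * (k : ℝ)) * X * (X ^ 2 - 1) ^ k := by
      rcases k with _ | k
      · simp
      · simp only [derivative_pow, derivative_sub, derivative_X_pow, derivative_one, map_mul]
        simp
        ring
    have h2 := congrArg derivative h1
    simp only [derivative_mul, derivative_sub, derivative_X_pow, derivative_one, derivative_C,
      derivative_X] at h2
    simp only [zero_add, Function.iterate_succ_apply', Function.iterate_zero, id]
    simp only [map_mul, map_sub, map_add, C_1, map_natCast, map_ofNat, map_one, map_zero] at h2 ⊢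
    simp at h2 ⊢
    linear_combination h2
  | succ j ih =>
    have h2 := congrArg derivative ih
    simp only [derivative_mul, derivative_add, derivative_sub, derivative_X_pow, derivative_one,
      derivative_C, derivative_X, ← Function.iterate_succ_apply' derivative] at h2
    simp only [map_mul, map_sub, map_add, C_1, map_natCast, map_ofNat, map_one, map_zero] at h2 ⊢
    simp only [Nat.succ_eq_add_one, add_assoc, Nat.reduceAdd] at h2 ⊢
    have e1 : 1 + 2 = 2 + 1 := rfl
    push_cast
    simp at h2 ⊢
    linear_combination h2

lemma legQ_ode (k m : ℕ) :
    (1 - X ^ 2 : ℝ[X]) * legQ k (m + 2) =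
      C (2 * ((m : ℝ) + 1)) * X * legQ k (m + 1) -
      C (((k : ℝ) - m) * (k + m + 1)) * legQ k m := by
  have h := rodrigues_ode k (k + m)
  simp only [legQ]
  simp only [map_mul, map_sub, map_add, C_1, map_natCast, map_ofNat, map_one, map_zero,
    Nat.cast_add, ← add_assoc] at h ⊢
  linear_combination (-C (1 / (2 ^ k * k.factorial : ℝ))) * h

lemma legQ_top (k : ℕ) :
    legQ k k = C ((2 * k).factorial / (2 ^ k * k.factorial : ℝ)) := by
  have hdeg : ((X ^ 2 - 1 : ℝ[X]) ^ k).natDegree = 2 * k := by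
    have : (X ^ 2 - 1 : ℝ[X]).natDegree = 2 := by
      rw [show (X ^ 2 - 1 : ℝ[X]) = X ^ 2 - C 1 by simp]; exact natDegree_X_pow_sub_C
    rw [natDegree_pow, this, mul_comm]
  have hmon : ((X ^ 2 - 1 : ℝ[X]) ^ k).Monic := by
    apply Monic.pow
    rw [show (X ^ 2 - 1 : ℝ[X]) = X ^ 2 - C 1 by simp]
    exact monic_X_pow_sub_C 1 (by norm_num)
  have h : derivative^[k + k] ((X ^ 2 - 1 : ℝ[X]) ^ k) = C ((2 * k).factorial : ℝ) := by
    have hd : (derivative^[k + k] ((X ^ 2 - 1 : ℝ[X]) ^ k)).natDegree = 0 := by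
      have := natDegree_iterate_derivative ((X ^ 2 - 1 : ℝ[X]) ^ k) (k + k)
      omega
    rw [eq_C_of_natDegree_eq_zero hd, coeff_iterate_derivative]
    have hc : ((X ^ 2 - 1 : ℝ[X]) ^ k).coeff (2 * k) = 1 := by
      rw [← hdeg]; exact hmon
    rw [show 0 + (k + k) = 2 * k by ring, hc, show k + k = 2 * k by ring,
      Nat.descFactorial_self]
    simp
  rw [legQ, h, ← C_mul]
  congr 1
  ring

/-- Integral of a polynomial over `[-1,1]`. -/
def pint (p : ℝ[X]) : ℝ := ∫ t in (-1 : ℝ)..1, p.eval t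

lemma pint_add (p q : ℝ[X]) : pint (p + q) = pint p + pint q := by
  simp only [pint, eval_add]
  exact intervalIntegral.integral_add (p.continuous.intervalIntegrable _ _)
    (q.continuous.intervalIntegrable _ _)

lemma pint_C_mul (c : ℝ) (p : ℝ[X]) : pint (C c * p) = c * pint p := by
  simp [pint]

lemma pint_derivative (p : ℝ[X]) : pint (derivative p) = p.eval 1 - p.eval (-1) := by
  unfold pint
  exact intervalIntegral.integral_eq_sub_of_hasDerivAt (fun t _ => p.hasDerivAt t)
    ((derivative p).continuous.intervalIntegrable _ _)

/-- `pint` as a linear map. -/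
def pintL : ℝ[X] →ₗ[ℝ] ℝ where
  toFun := pint
  map_add' := pint_add
  map_smul' c p := by rw [smul_eq_C_mul, pint_C_mul]; rfl

end LegendrePart

section LegendreInt
open Polynomial

lemma pint_sub (p q : ℝ[X]) : pint (p - q) = pint p - pint q := pintL.map_sub p q

lemma pint_closed {p r : ℝ[X]} (h : derivative p = r) (h1 : p.eval 1 = 0)
    (h2 : p.eval (-1) = 0) : pint r = 0 := by
  rw [← h, pint_derivative, h1, h2, sub_zero]

lemma derivV (m : ℕ) : derivative ((1 - X ^ 2 : ℝ[X]) ^ (m + 1)) =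
    -(2 * ((m : ℝ[X]) + 1)) * X * (1 - X ^ 2) ^ m := by
  simp only [derivative_pow, derivative_sub, derivative_X_pow, derivative_one]
  simp only [Nat.cast_add, Nat.cast_one, Nat.add_sub_cancel, map_add, map_one, map_natCast,
    Nat.cast_ofNat, map_ofNat, derivative_X, derivative_sq]
  ring

lemma pint_rel1 (k m : ℕ) :
    pint ((1 - X ^ 2) ^ m * legQ k m ^ 2) - (2 * m + 3) * pint ((1 - X ^ 2) ^ m * X ^ 2 * legQ k m ^ 2)
      + 2 * pint ((1 - X ^ 2) ^ (m + 1) * X * legQ k m * legQ k (m + 1)) = 0 := by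
  rw [← pint_C_mul, ← pint_C_mul, ← pint_sub, ← pint_add]
  apply pint_closed (p := (1 - X ^ 2) ^ (m + 1) * X * legQ k m ^ 2)
  · simp only [derivative_mul, derivV, derivative_X, derivative_sq, derivative_legQ]
    simp only [map_mul, map_add, map_natCast, map_ofNat]
    ring
  · simp
  · simp

lemma pint_rel2 (k m : ℕ) :
    pint ((1 - X ^ 2) ^ (m + 1) * legQ k (m + 1) ^ 2) -
      ((k - m) * (k + m + 1)) * pint ((1 - X ^ 2) ^ m * legQ k m ^ 2) = 0 := by
  rw [← pint_C_mul, ← pint_sub]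
  apply pint_closed (p := (1 - X ^ 2) ^ (m + 1) * legQ k m * legQ k (m + 1))
  · have h := legQ_ode k m
    simp only [derivative_mul, derivV, derivative_X, derivative_sq, derivative_legQ]
    simp only [map_mul, map_add, map_sub, map_natCast, map_ofNat, map_one] at h ⊢
    linear_combination ((1 - X ^ 2) ^ m * legQ k m) * h
  · simp
  · simp

lemma pint_rel3 (k m : ℕ) :
    pint ((1 - X ^ 2) ^ (m + 1) * X ^ 2 * legQ k (m + 1) ^ 2) -
      ((k - m) * (k + m + 1)) * pint ((1 - X ^ 2) ^ m * X ^ 2 * legQ k m ^ 2) +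
      2 * pint ((1 - X ^ 2) ^ (m + 1) * X * legQ k m * legQ k (m + 1)) = 0 := by
  rw [← pint_C_mul, ← pint_C_mul, ← pint_sub, ← pint_add]
  apply pint_closed (p := (1 - X ^ 2) ^ (m + 1) * X ^ 2 * legQ k m * legQ k (m + 1))
  · have h := legQ_ode k m
    simp only [derivative_mul, derivV, derivative_X, derivative_sq, derivative_legQ]
    simp only [map_mul, map_add, map_sub, map_natCast, map_ofNat, map_one] at h ⊢
    linear_combination ((1 - X ^ 2) ^ m * X ^ 2 * legQ k m) * h
  · simp
  · simp

lemma pint_rel4 (k m : ℕ) :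
    pint ((1 - X ^ 2) ^ (m + 1) * legQ k (m + 1) ^ 2) +
      (2 * m - 1) * pint ((1 - X ^ 2) ^ (m + 1) * X ^ 2 * legQ k (m + 1) ^ 2) -
      (2 * ((k - m) * (k + m + 1))) *
        pint ((1 - X ^ 2) ^ (m + 1) * X * legQ k m * legQ k (m + 1)) = 0 := by
  rw [← pint_C_mul, ← pint_C_mul, ← pint_add, ← pint_sub]
  apply pint_closed (p := (1 - X ^ 2) ^ (m + 1 + 1) * X * legQ k (m + 1) ^ 2)
  · have h := legQ_ode k m
    simp only [derivative_mul, derivV, derivative_X, derivative_sq, derivative_legQ]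
    simp only [map_mul, map_add, map_sub, map_natCast, map_ofNat, map_one] at h ⊢
    push_cast
    linear_combination (2 * (1 - X ^ 2) ^ (m + 1) * X * legQ k (m + 1)) * h
  · simp
  · simp

lemma pint_rel5 (k m : ℕ) :
    2 * m * pint ((1 - X ^ 2) ^ m * X * legQ k m * legQ k (m + 1)) -
      2 * (m ^ 2 * pint ((1 - X ^ 2) ^ (m - 1) * legQ k m ^ 2)) =
    - (m * (1 + 2 * m)) * pint ((1 - X ^ 2) ^ m * legQ k m ^ 2) := by
  rcases m with _ | m
  · simp
  · have : (1 + 2 * ((m + 1 : ℕ) : ℝ)) * pint ((1 - X ^ 2) ^ (m + 1) * legQ k (m + 1) ^ 2) +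
        2 * pint ((1 - X ^ 2) ^ (m + 1) * X * legQ k (m + 1) * legQ k (m + 1 + 1)) -
        (2 * ((m + 1 : ℕ) : ℝ)) * pint ((1 - X ^ 2) ^ m * legQ k (m + 1) ^ 2) = 0 := by
      rw [← pint_C_mul, ← pint_C_mul, ← pint_C_mul, ← pint_add, ← pint_sub]
      apply pint_closed (p := (1 - X ^ 2) ^ (m + 1) * X * legQ k (m + 1) ^ 2)
      · simp only [derivative_mul, derivV, derivative_X, derivative_sq, derivative_legQ]
        simp only [map_mul, map_add, map_sub, map_natCast, map_ofNat, map_one]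
        push_cast
        ring
      · simp
      · simp
    simp only [Nat.add_sub_cancel]
    linear_combination ((m + 1 : ℕ) : ℝ) * this

lemma pint_V (k : ℕ) :
    pint ((1 - X ^ 2) ^ k) = 2 ^ (2 * k + 1) * (k.factorial : ℝ) ^ 2 / (2 * k + 1).factorial := by
  induction k with
  | zero => simp [pint]; norm_num
  | succ k ih =>
    have : (2 * k + 3) * pint ((1 - X ^ 2) ^ (k + 1)) - (2 * (k + 1)) * pint ((1 - X ^ 2) ^ k) = 0 := by
      rw [← pint_C_mul, ← pint_C_mul, ← pint_sub]
      apply pint_closed (p := (1 - X ^ 2) ^ (k + 1) * X)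
      · simp only [derivative_mul, derivV, derivative_X]
        simp only [map_mul, map_add, map_sub, map_natCast, map_ofNat, map_one]
        ring
      · simp
      · simp
    rw [ih] at this
    have h3 : (2 * (k : ℝ) + 3) ≠ 0 := by positivity
    have e : pint ((1 - X ^ 2) ^ (k + 1)) = (2 * (k + 1)) *
        (2 ^ (2 * k + 1) * (k.factorial : ℝ) ^ 2 / (2 * k + 1).factorial) / (2 * k + 3) := by
      rw [eq_div_iff h3]; linear_combination this
    rw [e, show 2 * (k + 1) + 1 = (2 * k + 1) + 1 + 1 by ring, Nat.factorial_succ (2 * k + 1 + 1),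
      Nat.factorial_succ (2 * k + 1), Nat.factorial_succ k]
    push_cast
    have : ((2 * k + 1).factorial : ℝ) ≠ 0 := by positivity
    have h4 : (2 * (k : ℝ) + 1 + 1) ≠ 0 := by positivity
    have h5 : (2 * (k : ℝ) + 1 + 1 + 1) ≠ 0 := by positivity
    field_simp
    ring

lemma pint_norm (k j : ℕ) : ∀ m, m + j = k →
    pint ((1 - X ^ 2) ^ m * legQ k m ^ 2) * (j.factorial : ℝ) * (2 * k + 1) =
      2 * ((k + m).factorial : ℝ) := by
  induction j with
  | zero =>
    intro m hm
    obtain rfl : m = k := by simpa using hm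
    rw [legQ_top, ← C_pow, mul_comm, mul_comm ((1 - X ^ 2 : ℝ[X]) ^ m), pint_C_mul, pint_V,
      Nat.factorial_succ, show m + m = 2 * m by ring]
    have : ((2 * m).factorial : ℝ) ≠ 0 := by positivity
    have : (m.factorial : ℝ) ≠ 0 := by positivity
    have h4 : (2 * (m : ℝ) + 1) ≠ 0 := by positivity
    push_cast
    simp only [Nat.factorial_zero, Nat.cast_one]
    field_simp
    ring
  | succ j ih =>
    intro m hm
    have h1 := ih (m + 1) (by omega)
    have h2 := pint_rel2 k m
    have hk : (k : ℝ) - m = j + 1 := by rw [← hm]; push_cast; ring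
    rw [hk] at h2
    rw [show k + (m + 1) = (k + m) + 1 by ring, Nat.factorial_succ] at h1
    rw [Nat.factorial_succ]
    push_cast at h1 ⊢
    have h4 : ((k : ℝ) + m + 1) ≠ 0 := by positivity
    apply mul_left_cancel₀ h4
    linear_combination h1 - (j.factorial : ℝ) * (2 * k + 1) * h2

/-- The polynomial multiplying `cos² (mφ)`. -/
def angG (k m : ℕ) : ℝ[X] :=
  ((-C ((k : ℝ) + m + 1) * X * legQ k m + (1 - X ^ 2) * legQ k (m + 1)) ^ 2
    - (1 - X ^ 2) * (-C ((k : ℝ) + m + 1) * legQ k m - X * legQ k (m + 1)) ^ 2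
    - C (2 * (m : ℝ)) * legQ k m * (-C ((k : ℝ) + m + 1) * legQ k m - X * legQ k (m + 1)))
    * (1 - X ^ 2) ^ m

/-- The remaining polynomial. -/
def angR (k m : ℕ) : ℝ[X] := C ((m : ℝ) ^ 2) * ((1 - X ^ 2) ^ (m - 1) * legQ k m ^ 2)

lemma ang_total (k m : ℕ) (hm : m ≤ k) :
    pint (angG k m) - 2 * pint (angR k m) =
      -(2 * (k + 1 + 2 * (m : ℝ) ^ 2) * (k + m).factorial) / ((2 * k + 3) * (k - m).factorial) := by
  have hG : pint (angG k m) =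
      ((k : ℝ) + m + 1) ^ 2 * (2 * pint ((1 - X ^ 2) ^ m * X ^ 2 * legQ k m ^ 2)
        - pint ((1 - X ^ 2) ^ m * legQ k m ^ 2))
      - 4 * (k + m + 1) * pint ((1 - X ^ 2) ^ (m + 1) * X * legQ k m * legQ k (m + 1))
      + pint ((1 - X ^ 2) ^ (m + 1) * legQ k (m + 1) ^ 2)
      - 2 * pint ((1 - X ^ 2) ^ (m + 1) * X ^ 2 * legQ k (m + 1) ^ 2)
      + 2 * m * (k + m + 1) * pint ((1 - X ^ 2) ^ m * legQ k m ^ 2)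
      + 2 * m * pint ((1 - X ^ 2) ^ m * X * legQ k m * legQ k (m + 1)) := by
    simp only [← pint_C_mul, ← pint_sub, ← pint_add]
    congr 1
    simp only [angG, map_mul, map_add, map_sub, map_natCast, map_ofNat, map_one, map_pow]
    ring
  have r1 := pint_rel1 k m
  have r2 := pint_rel2 k m
  have r3 := pint_rel3 k m
  have r4 := pint_rel4 k m
  have r5 := pint_rel5 k m
  have r0 := pint_norm k (k - m) m (by omega)
  rw [hG, angR, pint_C_mul]
  generalize pint ((1 - X ^ 2) ^ m * X ^ 2 * legQ k m ^ 2) = I2 at *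
  generalize pint ((1 - X ^ 2) ^ m * legQ k m ^ 2) = I0 at *
  generalize pint ((1 - X ^ 2) ^ (m + 1) * X * legQ k m * legQ k (m + 1)) = B at *
  generalize pint ((1 - X ^ 2) ^ (m + 1) * legQ k (m + 1) ^ 2) = K0 at *
  generalize pint ((1 - X ^ 2) ^ (m + 1) * X ^ 2 * legQ k (m + 1) ^ 2) = K2 at *
  generalize pint ((1 - X ^ 2) ^ m * X * legQ k m * legQ k (m + 1)) = T at *
  generalize pint ((1 - X ^ 2) ^ (m - 1) * legQ k m ^ 2) = L at *
  have hf : ((k - m).factorial : ℝ) ≠ 0 := by positivity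
  have h3 : (2 * (k : ℝ) + 3) ≠ 0 := by positivity
  have hk1 : (2 * (k : ℝ) - 1) ≠ 0 := by
    intro h
    have : (2 * (k : ℤ) - 1) = 0 := by exact_mod_cast h
    omega
  have hB : B = -(I0 - (2 * m + 3) * I2) / 2 := by linear_combination r1 / 2
  have hK0 : K0 = ((k - m) * (k + m + 1)) * I0 := by linear_combination r2
  have hK2 : K2 = ((k - m) * (k + m + 1)) * I2 - 2 * B := by linear_combination r3
  have e2 : I2 * ((2 * k - 1) * (2 * k + 3)) =
      I0 * (2 * ((k - m) * (k + m + 1)) + 2 * m - 1) := by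
    rw [hK2, hK0, hB] at r4
    linear_combination -r4
  have e0 : I0 = 2 * ((k + m).factorial : ℝ) / ((k - m).factorial * (2 * k + 1)) := by
    rw [eq_div_iff (by positivity)]
    linear_combination r0
  have hT : 2 * m * T = 2 * (m ^ 2 * L) - (m * (1 + 2 * m)) * I0 := by linear_combination r5
  have key : (((k : ℝ) + m + 1) ^ 2 * (2 * I2 - I0) - 4 * (k + m + 1) * B + K0 - 2 * K2
      + 2 * m * (k + m + 1) * I0 + 2 * m * T - 2 * (m ^ 2 * L)) * (2 * k + 3) =
      -((k + 1 + 2 * m ^ 2) * (2 * k + 1)) * I0 := by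
    apply mul_left_cancel₀ hk1
    rw [hT, hK2, hK0, hB]
    linear_combination (2 * ((k : ℝ) + m + 1) ^ 2 - 2 * (k + m + 1) * (2 * m + 3)
      - 2 * ((k - m) * (k + m + 1)) + 2 * (2 * m + 3)) * e2
  rw [eq_div_iff (by positivity)]
  linear_combination ((k - m).factorial : ℝ) * key - (k + 1 + 2 * (m : ℝ) ^ 2) * r0

end LegendreInt

section GradPart
open Polynomial

/-- Smooth closed form of the exterior harmonic. -/
def Uf (k m : ℕ) (x : E3) : ℝ :=
  ((sphRho x)⁻¹) ^ (k + m + 1) * (legQ k m).eval (x 0 * (sphRho x)⁻¹) *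
    (((⟨x 1, x 2⟩ : ℂ)) ^ m).re

lemma re_pow_eq (a b : ℝ) (m : ℕ) :
    (((⟨a, b⟩ : ℂ)) ^ m).re = (Real.sqrt (a ^ 2 + b ^ 2)) ^ m * Real.cos (m * Complex.arg ⟨a, b⟩) := by
  have h := Complex.norm_mul_cos_add_sin_mul_I (⟨a, b⟩ : ℂ)
  have hn : ‖(⟨a, b⟩ : ℂ)‖ = Real.sqrt (a ^ 2 + b ^ 2) := by
    rw [Complex.norm_def, Complex.normSq_apply]; congr 1; simp; ring
  rw [← hn]
  conv_lhs => rw [← h, mul_pow, Complex.cos_add_sin_mul_I_pow]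
  rw [← Complex.ofReal_pow, Complex.re_ofReal_mul]
  congr 1
  rw [← Complex.ofReal_natCast, ← Complex.ofReal_mul, ← Complex.ofReal_cos, ← Complex.ofReal_sin]
  simp [-Complex.ofReal_mul, -Complex.ofReal_cos, -Complex.ofReal_sin]

lemma sq_rpow_half (y : ℝ) (hy : 0 ≤ y) (m : ℕ) : (y ^ 2) ^ ((m : ℝ) / 2) = y ^ m := by
  rw [← Real.rpow_natCast y 2, ← Real.rpow_mul hy, ← Real.rpow_natCast y m]
  congr 1
  push_cast
  ring

lemma dop_comps (a b c : ℝ) :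
    ((a : H) - qe1 * (b : H) - qe2 * (c : H)).re = a ∧
    ((a : H) - qe1 * (b : H) - qe2 * (c : H)).imI = -b ∧
    ((a : H) - qe1 * (b : H) - qe2 * (c : H)).imJ = -c := by
  have h1 : qe1.re = 0 := rfl
  have h2 : qe1.imI = 1 := rfl
  have h3 : qe1.imJ = 0 := rfl
  have h4 : qe1.imK = 0 := rfl
  have g1 : qe2.re = 0 := rfl
  have g2 : qe2.imI = 0 := rfl
  have g3 : qe2.imJ = 1 := rfl
  have g4 : qe2.imK = 0 := rfl
  refine ⟨?_, ?_, ?_⟩ <;> simp [h1, h2, h3, h4, g1, g2, g3, g4]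

lemma solidU_eq (k m : ℕ) (x : E3) (hx : 0 < sphRho x) :
    solidU (-((k : ℤ) + 1)) m true x = Uf k m x := by
  have h0 : ¬ (0 : ℤ) ≤ -((k : ℤ) + 1) := by omega
  have h1 : (- -((k : ℤ) + 1) - 1).toNat = k := by omega
  simp only [solidU, assocLegendre, if_neg h0, h1, assocLegendreNat, iteratedDeriv_legendreP, Uf,
    PhiFac, if_true, sphPhi, re_pow_eq]
  set r := sphRho x with hr
  have hr2 : r ^ 2 = x 0 ^ 2 + x 1 ^ 2 + x 2 ^ 2 := by
    rw [hr, sphRho, Real.sq_sqrt]; positivity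
  have hs : 0 ≤ x 1 ^ 2 + x 2 ^ 2 := by positivity
  have hv : 1 - (x 0 / r) ^ 2 = (Real.sqrt (x 1 ^ 2 + x 2 ^ 2) / r) ^ 2 := by
    rw [div_pow, div_pow, Real.sq_sqrt hs]
    field_simp
    linarith
  have hw : (1 - (x 0 / r) ^ 2) ^ ((m : ℝ) / 2) = (Real.sqrt (x 1 ^ 2 + x 2 ^ 2) / r) ^ m := by
    rw [hv, sq_rpow_half _ (by positivity)]
  rw [hw, zpow_neg, show ((k : ℤ) + 1) = ((k + 1 : ℕ) : ℤ) by push_cast; ring, zpow_natCast,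
    div_pow, div_eq_mul_inv (x 0) r, inv_pow]
  field_simp
  ring

lemma sphRho_pos {x : E3} (hx : x ≠ 0) : 0 < sphRho x := by
  rw [sphRho, Real.sqrt_pos]
  have : ‖x‖ ^ 2 = x 0 ^ 2 + x 1 ^ 2 + x 2 ^ 2 := by
    rw [EuclideanSpace.norm_sq_eq, Fin.sum_univ_three]; simp
  rw [← this]; have := norm_pos_iff.mpr hx; positivity

/-- coordinate projection. -/
def cproj (i : Fin 3) : E3 →L[ℝ] ℝ := EuclideanSpace.proj i

lemma cproj_apply (i : Fin 3) (x : E3) : cproj i x = x i := rfl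

lemma hasFDerivAt_coord (i : Fin 3) (x : E3) :
    HasFDerivAt (fun y : E3 => y i) (cproj i) x := (cproj i).hasFDerivAt

lemma hasFDerivAt_rhoInv {x : E3} (hx : x ≠ 0) :
    HasFDerivAt (fun y : E3 => (sphRho y)⁻¹)
      (-((sphRho x)⁻¹ ^ 3) • (x 0 • cproj 0 + x 1 • cproj 1 + x 2 • cproj 2)) x := by
  have hp := sphRho_pos hx
  have hr2 : sphRho x ^ 2 = x 0 ^ 2 + x 1 ^ 2 + x 2 ^ 2 := by
    rw [sphRho, Real.sq_sqrt]; positivity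
  have h1 : HasFDerivAt (fun y : E3 => y 0 ^ 2 + y 1 ^ 2 + y 2 ^ 2)
      ((2 * x 0) • cproj 0 + (2 * x 1) • cproj 1 + (2 * x 2) • cproj 2) x := by
    have := (((hasFDerivAt_coord 0 x).pow 2).add ((hasFDerivAt_coord 1 x).pow 2)).add
      ((hasFDerivAt_coord 2 x).pow 2)
    refine this.congr_fderiv ?_
    ext v
    simp
  have hne : x 0 ^ 2 + x 1 ^ 2 + x 2 ^ 2 ≠ 0 := by rw [← hr2]; positivity
  have h2 := h1.sqrt hne
  have h3 := (hasDerivAt_inv hp.ne').comp_hasFDerivAt x h2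
  refine h3.congr_fderiv ?_
  ext v
  simp only [smul_apply, add_apply, smul_eq_mul,
    cproj_apply]
  rw [show Real.sqrt (x 0 ^ 2 + x 1 ^ 2 + x 2 ^ 2) = sphRho x from rfl]
  field_simp

/-- The complex coordinate `x₁ + i x₂`. -/
def cz : E3 →L[ℝ] ℂ := Complex.ofRealCLM.comp (cproj 1) + Complex.I • Complex.ofRealCLM.comp (cproj 2)

lemma cz_apply (x : E3) : cz x = ⟨x 1, x 2⟩ := by
  apply Complex.ext <;> simp [cz, cproj_apply]

lemma hasFDerivAt_rePow (m : ℕ) (x : E3) :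
    HasFDerivAt (fun y : E3 => (((⟨y 1, y 2⟩ : ℂ)) ^ m).re)
      ((m * (((⟨x 1, x 2⟩ : ℂ)) ^ (m - 1)).re) • cproj 1
        - (m * (((⟨x 1, x 2⟩ : ℂ)) ^ (m - 1)).im) • cproj 2) x := by
  have h1 : HasFDerivAt (fun y : E3 => (cz y) ^ m) _ x := cz.hasFDerivAt.pow m
  have h2 := Complex.reCLM.hasFDerivAt.comp x h1
  have h3 : (fun y : E3 => (((⟨y 1, y 2⟩ : ℂ)) ^ m).re) = Complex.reCLM ∘ (fun y => (cz y) ^ m) := by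
    funext y; simp [cz_apply]
  rw [h3]
  refine h2.congr_fderiv ?_
  ext v
  simp [cz_apply, cproj_apply, Complex.mul_re]

lemma hasFDerivAt_Uf (k m : ℕ) {x : E3} (hx : x ≠ 0) :
    let q := (sphRho x)⁻¹
    let t := x 0 * q
    let Q := (legQ k m).eval t
    let Q' := (legQ k (m + 1)).eval t
    let Cm := (((⟨x 1, x 2⟩ : ℂ)) ^ m).re
    let c := (((⟨x 1, x 2⟩ : ℂ)) ^ (m - 1)).re
    let s := (((⟨x 1, x 2⟩ : ℂ)) ^ (m - 1)).im
    let D := -(k + m + 1 : ℝ) * Q - t * Q'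
    HasFDerivAt (Uf k m)
      ((q ^ (k + m + 2) * (-(k + m + 1 : ℝ) * t * Q + (1 - t ^ 2) * Q') * Cm) • cproj 0
       + (q ^ (k + m + 3) * x 1 * D * Cm + q ^ (k + m + 1) * Q * (m * c)) • cproj 1
       + (q ^ (k + m + 3) * x 2 * D * Cm - q ^ (k + m + 1) * Q * (m * s)) • cproj 2) x := by
  intro q t Q Q' Cm c s D
  have hq := hasFDerivAt_rhoInv hx
  have ht := (hasFDerivAt_coord 0 x).mul hq
  have hQ := ((legQ k m).hasDerivAt t).comp_hasFDerivAt x ht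
  rw [derivative_legQ] at hQ
  have h := ((hq.pow (k + m + 1)).mul hQ).mul (hasFDerivAt_rePow m x)
  refine h.congr_fderiv ?_
  ext v
  simp only [smul_apply, add_apply, smul_eq_mul,
    sub_apply, cproj_apply, Function.comp, nsmul_eq_mul, Nat.add_sub_cancel]
  simp only [← show q = (sphRho x)⁻¹ from rfl, ← show t = x 0 * q from rfl]
  simp only [show eval t (legQ k m) = Q from rfl, show eval t (legQ k (m + 1)) = Q' from rfl,
   show (((⟨x 1, x 2⟩ : ℂ)) ^ m).re = Cm from rfl, show (((⟨x 1, x 2⟩ : ℂ)) ^ (m - 1)).re = c from rfl,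
   show (((⟨x 1, x 2⟩ : ℂ)) ^ (m - 1)).im = s from rfl]
  simp only [D, t]
  push_cast
  simp
  ring

lemma qip_X (k m : ℕ) {x : E3} (hx : x ≠ 0) :
    qip (star (Xmon (-((k : ℤ) + 2)) m true x)) (Xmon (-((k : ℤ) + 2)) m true x) =
      (fderiv ℝ (Uf k m) x (EuclideanSpace.single 0 1)) ^ 2
      - (fderiv ℝ (Uf k m) x (EuclideanSpace.single 1 1)) ^ 2
      - (fderiv ℝ (Uf k m) x (EuclideanSpace.single 2 1)) ^ 2 := by
  have hev : solidUq (-((k : ℤ) + 1)) m true =ᶠ[nhds x] fun y => ((Uf k m y : ℝ) : H) := by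
    filter_upwards [isOpen_ne.mem_nhds hx] with y hy
    rw [solidUq, solidU_eq k m y (sphRho_pos hy)]
  have hd : DifferentiableAt ℝ (Uf k m) x := (hasFDerivAt_Uf k m hx).differentiableAt
  have hpd : ∀ i, pd i (solidUq (-((k : ℤ) + 1)) m true) x =
      ((fderiv ℝ (Uf k m) x (EuclideanSpace.single i 1) : ℝ) : H) := by
    intro i
    rw [pd, hev.fderiv_eq]
    let L : ℝ →L[ℝ] H := LinearMap.toContinuousLinearMap (Algebra.linearMap ℝ H)
    have : HasFDerivAt (fun y => ((Uf k m y : ℝ) : H)) (L.comp (fderiv ℝ (Uf k m) x)) x :=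
      L.hasFDerivAt.comp x hd.hasFDerivAt
    rw [this.fderiv]
    rfl
  rw [Xmon, show (-((k : ℤ) + 2) + 1) = -((k : ℤ) + 1) by ring]
  simp only [Dop, hpd, qip, Quaternion.re_star, Quaternion.imI_star, Quaternion.imJ_star,
    (dop_comps _ _ _).1, (dop_comps _ _ _).2.1, (dop_comps _ _ _).2.2]
  ring

lemma qip_X' (k m : ℕ) {x : E3} (hx : x ≠ 0) :
    let q := (sphRho x)⁻¹
    let t := x 0 * q
    let Q := (legQ k m).eval t
    let Q' := (legQ k (m + 1)).eval t
    let Cm := (((⟨x 1, x 2⟩ : ℂ)) ^ m).re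
    let D := -(k + m + 1 : ℝ) * Q - t * Q'
    qip (star (Xmon (-((k : ℤ) + 2)) m true x)) (Xmon (-((k : ℤ) + 2)) m true x) =
      (q ^ (k + m + 2) * (-(k + m + 1 : ℝ) * t * Q + (1 - t ^ 2) * Q')) ^ 2 * Cm ^ 2
      - (q ^ (k + m + 3) * D) ^ 2 * (x 1 ^ 2 + x 2 ^ 2) * Cm ^ 2
      - 2 * m * (q ^ (k + m + 2)) ^ 2 * D * Q * Cm ^ 2
      - (q ^ (k + m + 1) * Q) ^ 2 * (m ^ 2 * (x 1 ^ 2 + x 2 ^ 2) ^ (m - 1)) := by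
  intro q t Q Q' Cm D
  rw [qip_X k m hx, (hasFDerivAt_Uf k m hx).fderiv]
  have h1 : (m : ℝ) * (x 1 * (((⟨x 1, x 2⟩ : ℂ)) ^ (m - 1)).re - x 2 * (((⟨x 1, x 2⟩ : ℂ)) ^ (m - 1)).im)
      = m * Cm := by
    rcases m with _ | m
    · simp
    · simp only [Nat.add_sub_cancel, Cm, pow_succ, Complex.mul_re]
      ring
  have h2 : (((⟨x 1, x 2⟩ : ℂ)) ^ (m - 1)).re ^ 2 + (((⟨x 1, x 2⟩ : ℂ)) ^ (m - 1)).im ^ 2 =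
      (x 1 ^ 2 + x 2 ^ 2) ^ (m - 1) := by
    have := map_pow Complex.normSq (⟨x 1, x 2⟩ : ℂ) (m - 1)
    rw [Complex.normSq_apply, Complex.normSq_apply] at this
    simp only at this
    rw [sq, sq, this]; ring
  simp only [smul_apply, add_apply, smul_eq_mul,
    cproj_apply]
  simp
  simp only [← show q = (sphRho x)⁻¹ from rfl, ← show t = x 0 * q from rfl]
  simp only [show eval t (legQ k m) = Q from rfl, show eval t (legQ k (m + 1)) = Q' from rfl,
   show (((⟨x 1, x 2⟩ : ℂ)) ^ m).re = Cm from rfl]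
  generalize (((⟨x 1, x 2⟩ : ℂ)) ^ (m - 1)).re = c at *
  generalize (((⟨x 1, x 2⟩ : ℂ)) ^ (m - 1)).im = s at *
  rw [← h2]
  simp only [D]
  linear_combination (-2 * q ^ (k + m + 3) * q ^ (k + m + 1) * D * Q * Cm) * h1

end GradPart

section SphPart
open Set

/-- Spherical coordinates map. -/
def sphMap (p : Fin 3 → ℝ) : Fin 3 → ℝ :=
  ![p 0 * cos (p 1), p 0 * sin (p 1) * cos (p 2), p 0 * sin (p 1) * sin (p 2)]

/-- Parameter domain. -/
def sphDom : Set (Fin 3 → ℝ) := Set.pi univ ![Ioi 1, Ioo 0 π, Ioo (-π) π]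

/-- Jacobian. -/
def sphJac (p : Fin 3 → ℝ) : (Fin 3 → ℝ) →L[ℝ] (Fin 3 → ℝ) :=
  LinearMap.toContinuousLinearMap (Matrix.toLin'
    !![cos (p 1), -(p 0 * sin (p 1)), 0;
       sin (p 1) * cos (p 2), p 0 * cos (p 1) * cos (p 2), -(p 0 * sin (p 1) * sin (p 2));
       sin (p 1) * sin (p 2), p 0 * cos (p 1) * sin (p 2), p 0 * sin (p 1) * cos (p 2)])

lemma mem_sphDom {p : Fin 3 → ℝ} :
    p ∈ sphDom ↔ 1 < p 0 ∧ (0 < p 1 ∧ p 1 < π) ∧ (-π < p 2 ∧ p 2 < π) := by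
  simp [sphDom, Set.mem_pi, Fin.forall_fin_succ]

lemma sphJac_det (p : Fin 3 → ℝ) : (sphJac p).det = p 0 ^ 2 * sin (p 1) := by
  rw [sphJac, LinearMap.det_toContinuousLinearMap, LinearMap.det_toLin', Matrix.det_fin_three]
  simp
  have h1 := Real.sin_sq_add_cos_sq (p 1)
  have h2 := Real.sin_sq_add_cos_sq (p 2)
  have e1 : cos (p 1) ^ 2 = 1 - sin (p 1) ^ 2 := by linarith
  have e2 : cos (p 2) ^ 2 = 1 - sin (p 2) ^ 2 := by linarith
  ring_nf
  simp only [e1, e2]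
  ring

lemma sphMap_hasFDerivAt (p : Fin 3 → ℝ) : HasFDerivAt sphMap (sphJac p) p := by
  have hp : ∀ i : Fin 3, HasFDerivAt (fun q : Fin 3 → ℝ => q i)
      (ContinuousLinearMap.proj (R := ℝ) (φ := fun _ : Fin 3 => ℝ) i) p := fun i =>
    (ContinuousLinearMap.proj (R := ℝ) (φ := fun _ : Fin 3 => ℝ) i).hasFDerivAt
  have hc1 := (Real.hasDerivAt_cos (p 1)).comp_hasFDerivAt p (hp 1)
  have hs1 := (Real.hasDerivAt_sin (p 1)).comp_hasFDerivAt p (hp 1)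
  have hc2 := (Real.hasDerivAt_cos (p 2)).comp_hasFDerivAt p (hp 2)
  have hs2 := (Real.hasDerivAt_sin (p 2)).comp_hasFDerivAt p (hp 2)
  rw [hasFDerivAt_pi']
  intro i
  fin_cases i
  · refine ((hp 0).mul hc1).congr_fderiv ?_
    ext v
    simp [sphJac, Matrix.mulVec, dotProduct, Fin.sum_univ_three, Function.comp]
    ring
  · refine (((hp 0).mul hs1).mul hc2).congr_fderiv ?_
    ext v
    simp [sphJac, Matrix.mulVec, dotProduct, Fin.sum_univ_three, Function.comp]
    ring
  · refine (((hp 0).mul hs1).mul hs2).congr_fderiv ?_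
    ext v
    simp [sphJac, Matrix.mulVec, dotProduct, Fin.sum_univ_three, Function.comp]
    ring

lemma sphMap_normsq (p : Fin 3 → ℝ) :
    sphMap p 0 ^ 2 + sphMap p 1 ^ 2 + sphMap p 2 ^ 2 = p 0 ^ 2 := by
  simp only [sphMap, Matrix.cons_val]
  have h1 := Real.sin_sq_add_cos_sq (p 1)
  have h2 := Real.sin_sq_add_cos_sq (p 2)
  linear_combination p 0 ^ 2 * h1 + p 0 ^ 2 * sin (p 1) ^ 2 * h2

lemma sphMap_injOn : InjOn sphMap sphDom := by
  intro p hp q hq h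
  rw [mem_sphDom] at hp hq
  obtain ⟨hp0, hp1, hp2⟩ := hp
  obtain ⟨hq0, hq1, hq2⟩ := hq
  have h0 : p 0 = q 0 := by
    have : p 0 ^ 2 = q 0 ^ 2 := by rw [← sphMap_normsq p, ← sphMap_normsq q, h]
    nlinarith
  have e0 := congrFun h 0
  have e1 := congrFun h 1
  have e2 := congrFun h 2
  simp only [sphMap, Matrix.cons_val] at e0 e1 e2
  rw [h0] at e0 e1 e2
  have hq0' : q 0 ≠ 0 := by linarith
  have c1 : cos (p 1) = cos (q 1) := mul_left_cancel₀ hq0' e0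
  have h1 : p 1 = q 1 := Real.injOn_cos ⟨hp1.1.le, hp1.2.le⟩ ⟨hq1.1.le, hq1.2.le⟩ c1
  rw [h1] at e1 e2
  have hs : sin (q 1) ≠ 0 := (Real.sin_pos_of_pos_of_lt_pi hq1.1 hq1.2).ne'
  have hqs : q 0 * sin (q 1) ≠ 0 := mul_ne_zero hq0' hs
  have c2 := mul_left_cancel₀ hqs e1
  have s2 := mul_left_cancel₀ hqs e2
  have h2 : p 2 - q 2 = 0 := by
    have : cos (p 2 - q 2) = 1 := by
      rw [Real.cos_sub, c2, s2]; nlinarith [Real.sin_sq_add_cos_sq (q 2)]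
    exact (Real.cos_eq_one_iff_of_lt_of_lt (by linarith [hp2.1, hq2.2])
      (by linarith [hp2.2, hq2.1])).1 this
  funext i
  fin_cases i
  · exact h0
  · exact h1
  · exact sub_eq_zero.1 h2

/-- Exterior region in plain coordinates. -/
def extPi : Set (Fin 3 → ℝ) := {y | 1 < y 0 ^ 2 + y 1 ^ 2 + y 2 ^ 2}

lemma mem_extPi {y : Fin 3 → ℝ} : y ∈ extPi ↔ 1 < y 0 ^ 2 + y 1 ^ 2 + y 2 ^ 2 := by
  simp [extPi]

lemma sph_image_subset : sphMap '' sphDom ⊆ extPi := by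
  rintro _ ⟨p, hp, rfl⟩
  rw [mem_sphDom] at hp
  rw [mem_extPi, sphMap_normsq]
  nlinarith [hp.1]

lemma sph_diff_null : extPi \ (sphMap '' sphDom) ⊆ {y | y 2 = 0} := by
  rintro y ⟨hy, hn⟩
  by_contra h2
  apply hn
  rw [mem_extPi] at hy
  simp only [mem_ofPred_eq] at h2
  set r := Real.sqrt (y 0 ^ 2 + y 1 ^ 2 + y 2 ^ 2) with hr
  have hr2 : r ^ 2 = y 0 ^ 2 + y 1 ^ 2 + y 2 ^ 2 := Real.sq_sqrt (by positivity)
  have hr1 : 1 < r := by rw [hr]; exact Real.lt_sqrt_of_sq_lt (by simpa using hy)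
  have hy2 : 0 < y 2 ^ 2 := by positivity
  have habs : |y 0| < r := by
    apply abs_lt_of_sq_lt_sq _ (by linarith)
    rw [hr2]; nlinarith [sq_nonneg (y 1)]
  obtain ⟨ha, hb⟩ := abs_lt.1 habs
  have hl : -1 < y 0 / r := by rw [lt_div_iff₀ (by linarith)]; linarith
  have hu : y 0 / r < 1 := by rw [div_lt_one (by linarith)]; linarith
  set z : ℂ := ⟨y 1, y 2⟩ with hz
  have hnz : ‖z‖ = Real.sqrt (y 1 ^ 2 + y 2 ^ 2) := by
    rw [Complex.norm_def, Complex.normSq_apply]; congr 1; simp [hz]; ring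
  have hsin : r * sin (arccos (y 0 / r)) = ‖z‖ := by
    rw [Real.sin_arccos, hnz]
    have : 1 - (y 0 / r) ^ 2 = (y 1 ^ 2 + y 2 ^ 2) / r ^ 2 := by
      have : r ≠ 0 := by linarith
      field_simp
      linarith
    rw [this, Real.sqrt_div (by positivity), Real.sqrt_sq (by linarith)]
    have : r ≠ 0 := by linarith
    field_simp
  refine ⟨![r, arccos (y 0 / r), Complex.arg z], ?_, ?_⟩
  · rw [mem_sphDom]
    simp only [Matrix.cons_val]
    refine ⟨hr1, ⟨Real.arccos_pos.2 hu, ?_⟩, Complex.neg_pi_lt_arg z, ?_⟩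
    · refine lt_of_le_of_ne (Real.arccos_le_pi _) ?_
      rw [Ne, Real.arccos_eq_pi]; linarith
    · refine lt_of_le_of_ne (Complex.arg_le_pi _) ?_
      rw [Ne, Complex.arg_eq_pi_iff]
      rintro ⟨_, h⟩
      exact h2 h
  · funext i
    fin_cases i
    · simp only [sphMap, Matrix.cons_val, Fin.zero_eta]
      rw [Real.cos_arccos hl.le hu.le]
      have : r ≠ 0 := by linarith
      field_simp
    · simp only [sphMap, Matrix.cons_val, Fin.mk_one]
      rw [hsin, Complex.norm_mul_cos_arg]
    · simp only [sphMap, Matrix.cons_val, Fin.reduceFinMk]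
      rw [hsin, Complex.norm_mul_sin_arg]

lemma image_ae : (sphMap '' sphDom : Set (Fin 3 → ℝ)) =ᵐ[volume] extPi := by
  apply LE.le.eventuallyLE sph_image_subset |>.antisymm
  rw [ae_le_set]
  refine measure_mono_null sph_diff_null ?_
  exact Measure.pi_hyperplane (fun _ : Fin 3 => (volume : Measure ℝ)) 2 0

lemma integral_ext (f : E3 → ℝ) :
    ∫ x in extB, f x = ∫ p in sphDom, p 0 ^ 2 * sin (p 1) * f (WithLp.toLp 2 (sphMap p)) := by
  have h1 : ∫ x in extB, f x = ∫ y in extPi, f (WithLp.toLp 2 y) := by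
    have hmp := PiLp.volume_preserving_toLp (Fin 3)
    have hset : (WithLp.toLp 2 : (Fin 3 → ℝ) → E3) ⁻¹' extB = extPi := by
      ext y
      have : ‖(WithLp.toLp 2 y : E3)‖ ^ 2 = y 0 ^ 2 + y 1 ^ 2 + y 2 ^ 2 := by
        rw [EuclideanSpace.norm_sq_eq, Fin.sum_univ_three]; simp
      rw [mem_extPi, extB, mem_preimage, mem_ofPred_eq, ← this, one_lt_sq_iff₀ (norm_nonneg _)]
    rw [← hset]
    exact (hmp.setIntegral_preimage_emb
      (MeasurableEquiv.toLp 2 (Fin 3 → ℝ)).measurableEmbedding f extB).symm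
  have hmeas : MeasurableSet sphDom := by
    refine MeasurableSet.univ_pi fun i => ?_
    fin_cases i
    · exact measurableSet_Ioi
    · exact measurableSet_Ioo
    · exact measurableSet_Ioo
  rw [h1, ← setIntegral_congr_set image_ae,
    integral_image_eq_integral_abs_det_fderiv_smul volume hmeas
      (fun p _ => (sphMap_hasFDerivAt p).hasFDerivWithinAt) sphMap_injOn]
  refine setIntegral_congr_fun hmeas fun p hp => ?_
  rw [mem_sphDom] at hp
  have : 0 < sin (p 1) := Real.sin_pos_of_pos_of_lt_pi hp.2.1.1 hp.2.1.2
  simp only [sphJac_det, smul_eq_mul]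
  rw [abs_of_nonneg (by positivity)]

end SphPart

section FinalPart
open Set Polynomial

lemma sphMap_cpow (p : Fin 3 → ℝ) (m : ℕ) :
    (((⟨sphMap p 1, sphMap p 2⟩ : ℂ)) ^ m).re = (p 0 * sin (p 1)) ^ m * cos (m * p 2) := by
  have h : (⟨sphMap p 1, sphMap p 2⟩ : ℂ) = ((p 0 * sin (p 1) : ℝ) : ℂ) *
      (Complex.cos (p 2 : ℝ) + Complex.sin (p 2 : ℝ) * Complex.I) := by
    rw [← Complex.ofReal_cos, ← Complex.ofReal_sin]
    apply Complex.ext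
    · simp [sphMap, -Complex.ofReal_mul, -Complex.ofReal_cos, -Complex.ofReal_sin]
    · simp [sphMap, -Complex.ofReal_mul, -Complex.ofReal_cos, -Complex.ofReal_sin]
  rw [h, mul_pow, Complex.cos_add_sin_mul_I_pow, ← Complex.ofReal_pow, Complex.re_ofReal_mul]
  congr 1
  rw [← Complex.ofReal_natCast, ← Complex.ofReal_mul, ← Complex.ofReal_cos, ← Complex.ofReal_sin]
  simp [-Complex.ofReal_mul, -Complex.ofReal_cos, -Complex.ofReal_sin]

lemma integrand_eq (k m : ℕ) (p : Fin 3 → ℝ) (hp : p ∈ sphDom) :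
    p 0 ^ 2 * sin (p 1) * qip (star (Xmon (-((k : ℤ) + 2)) m true (WithLp.toLp 2 (sphMap p))))
      (Xmon (-((k : ℤ) + 2)) m true (WithLp.toLp 2 (sphMap p))) =
    ((p 0)⁻¹ ^ (2 * k + 2) * (sin (p 1) * (angG k m).eval (cos (p 1))) * cos (m * p 2) ^ 2)
     - ((p 0)⁻¹ ^ (2 * k + 2) * (sin (p 1) * (angR k m).eval (cos (p 1))) * 1) := by
  rw [mem_sphDom] at hp
  have hp0 : 0 < p 0 := by linarith [hp.1]
  set x : E3 := WithLp.toLp 2 (sphMap p) with hxdef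
  have hrho : sphRho x = p 0 := by
    have := sphMap_normsq p
    change Real.sqrt (sphMap p 0 ^ 2 + sphMap p 1 ^ 2 + sphMap p 2 ^ 2) = p 0
    rw [this, Real.sqrt_sq hp0.le]
  have hx : x ≠ 0 := by
    intro h
    rw [h] at hrho
    simp [sphRho] at hrho
    linarith
  have h := qip_X' k m hx
  have x0 : x 0 = p 0 * cos (p 1) := rfl
  have x1 : x 1 = sphMap p 1 := rfl
  have x2 : x 2 = sphMap p 2 := rfl
  have hsig : sphMap p 1 ^ 2 + sphMap p 2 ^ 2 = p 0 ^ 2 * sin (p 1) ^ 2 := by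
    simp only [sphMap, Matrix.cons_val]
    have h2 := Real.sin_sq_add_cos_sq (p 2)
    linear_combination p 0 ^ 2 * sin (p 1) ^ 2 * h2
  have ht : p 0 * cos (p 1) * (p 0)⁻¹ = cos (p 1) := by field_simp
  simp only [hrho, x0, x1, x2, ht, sphMap_cpow, hsig] at h
  rw [h]
  simp only [angG, angR, eval_mul, eval_sub, eval_add, eval_pow, eval_C, eval_X, eval_one, eval_neg]
  have hv : 1 - cos (p 1) ^ 2 = sin (p 1) ^ 2 := by linarith [Real.sin_sq_add_cos_sq (p 1)]
  rw [hv]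
  have hpow : ∀ a : ℕ, (p 0)⁻¹ ^ (a + m) * p 0 ^ m = (p 0)⁻¹ ^ a := by
    intro a
    rw [pow_add, mul_assoc, ← mul_pow, inv_mul_cancel₀ hp0.ne', one_pow, mul_one]
  generalize eval (cos (p 1)) (legQ k m) = Q
  generalize eval (cos (p 1)) (legQ k (m + 1)) = Q'
  generalize cos ((m : ℝ) * p 2) = c
  generalize cos (p 1) = t
  generalize sin (p 1) = w
  have hpp : ∀ a b : ℕ, (p 0)⁻¹ ^ (a + b) * p 0 ^ b = (p 0)⁻¹ ^ a := by
    intro a b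
    rw [pow_add, mul_assoc, ← mul_pow, inv_mul_cancel₀ hp0.ne', one_pow, mul_one]
  have e1 := hpp (2 * k + 2) (2 * m + 2)
  have e2 := hpp (2 * k + 2) (2 * m + 4)
  rcases m with _ | m
  · simp only [Nat.cast_zero] at *
    linear_combination (w * ((-(k + 0 + 1 : ℝ) * t * Q + w ^ 2 * Q') ^ 2) * c ^ 2) * e1
       - (w * (-(k + 0 + 1 : ℝ) * Q - t * Q') ^ 2 * w ^ 2 * c ^ 2) * e2
  · have e3 := hpp (2 * k + 2) (2 * m + 2)
    simp only [Nat.add_sub_cancel]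
    push_cast at *
    linear_combination
      (w * ((-(k + (m + 1) + 1 : ℝ) * t * Q + w ^ 2 * Q') ^ 2
        - 2 * (m + 1) * (-(k + (m + 1) + 1 : ℝ) * Q - t * Q') * Q) * (w ^ (m + 1)) ^ 2 * c ^ 2) * e1
       - (w * (-(k + (m + 1) + 1 : ℝ) * Q - t * Q') ^ 2 * w ^ 2 * (w ^ (m + 1)) ^ 2 * c ^ 2) * e2
       - (w * Q ^ 2 * (m + 1) ^ 2 * (w ^ m) ^ 2) * e3

lemma radial_integrable (k : ℕ) :
    Integrable (fun r : ℝ => r⁻¹ ^ (2 * k + 2)) (volume.restrict (Ioi 1)) := by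
  have h := integrableOn_Ioi_rpow_of_lt (a := -(2 * k + 2 : ℝ)) (c := 1) (by linarith [k.cast_nonneg (α := ℝ)]) one_pos
  refine (integrableOn_congr_fun (fun r hr => ?_) measurableSet_Ioi).1 h
  have : (0 : ℝ) < r := lt_trans one_pos hr
  simp only [Real.rpow_neg this.le, inv_pow]
  rw [← Real.rpow_natCast]
  push_cast
  rfl

lemma radial_integral (k : ℕ) :
    ∫ r in Ioi (1 : ℝ), r⁻¹ ^ (2 * k + 2) = 1 / (2 * k + 1) := by
  have h := integral_Ioi_rpow_of_lt (a := -(2 * k + 2 : ℝ)) (c := 1) (by linarith [k.cast_nonneg (α := ℝ)]) one_pos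
  have e : ∫ r in Ioi (1 : ℝ), r⁻¹ ^ (2 * k + 2) = ∫ r in Ioi (1 : ℝ), r ^ (-(2 * k + 2 : ℝ)) := by
    refine setIntegral_congr_fun measurableSet_Ioi fun r hr => ?_
    have : (0 : ℝ) < r := lt_trans one_pos hr
    simp only [Real.rpow_neg this.le, inv_pow]
    rw [← Real.rpow_natCast]
    push_cast
    rfl
  rw [e, h, Real.one_rpow]
  have : (2 * (k : ℝ) + 1) ≠ 0 := by positivity
  rw [show -(2 * (k : ℝ) + 2) + 1 = -(2 * k + 1) by ring, neg_div_neg_eq]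

lemma polar_integral (P : ℝ[X]) :
    ∫ θ in Ioo 0 π, sin θ * P.eval (cos θ) = pint P := by
  rw [← integral_Ioc_eq_integral_Ioo, ← intervalIntegral.integral_of_le Real.pi_pos.le]
  have h := intervalIntegral.integral_comp_mul_deriv (a := 0) (b := π) (f := cos)
    (f' := fun θ => -sin θ) (g := fun t => P.eval t)
    (fun x _ => Real.hasDerivAt_cos x) (by fun_prop) P.continuous
  rw [Real.cos_zero, Real.cos_pi, intervalIntegral.integral_symm (-1) 1] at h
  rw [pint, ← neg_inj, ← h, ← intervalIntegral.integral_neg]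
  congr 1
  funext θ
  simp only [Function.comp]
  ring

lemma azimuth_integral (m : ℕ) :
    ∫ φ in Ioo (-π) π, cos (m * φ) ^ 2 = π * (1 + if m = 0 then (1 : ℝ) else 0) := by
  rw [← integral_Ioc_eq_integral_Ioo, ← intervalIntegral.integral_of_le (by linarith [Real.pi_pos])]
  split_ifs with h
  · subst h; simp; ring
  · have hm : (m : ℝ) ≠ 0 := by exact_mod_cast h
    have hd : ∀ x ∈ uIcc (-π) π, HasDerivAt (fun φ : ℝ => φ / 2 + sin (2 * (m * φ)) / (4 * m))
        (cos (m * x) ^ 2) x := by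
      intro x _
      have h1 : HasDerivAt (fun φ : ℝ => 2 * (m * φ)) (2 * (m * 1)) x :=
        ((hasDerivAt_id x).const_mul (m : ℝ)).const_mul 2
      have h2 := ((hasDerivAt_id x).div_const 2).add (h1.sin.div_const (4 * m))
      refine h2.congr_deriv ?_
      rw [Real.cos_two_mul]
      field_simp
      ring
    rw [intervalIntegral.integral_eq_sub_of_hasDerivAt hd
      (by apply Continuous.intervalIntegrable; fun_prop)]
    have s1 : sin (2 * (m * π)) = 0 := by
      have := Real.sin_nat_mul_pi (2 * m)
      push_cast at this
      rw [← this]; ring_nf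
    have s2 : sin (2 * (m * -π)) = 0 := by
      rw [show 2 * ((m : ℝ) * -π) = -(2 * (m * π)) by ring, Real.sin_neg, s1, neg_zero]
    rw [s1, s2]
    ring

lemma restrict_sphDom : (volume.restrict sphDom : Measure (Fin 3 → ℝ)) =
    Measure.pi (fun i => volume.restrict ((![Ioi 1, Ioo 0 π, Ioo (-π) π] : Fin 3 → Set ℝ) i)) := by
  rw [sphDom, volume_pi, Measure.restrict_pi_pi]

lemma prod_integral (f g h : ℝ → ℝ) :
    ∫ p in sphDom, f (p 0) * g (p 1) * h (p 2) =
      (∫ r in Ioi 1, f r) * (∫ θ in Ioo 0 π, g θ) * ∫ φ in Ioo (-π) π, h φ := by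
  rw [restrict_sphDom]
  have := integral_fintype_prod_eq_prod (𝕜 := ℝ) (ι := Fin 3) (E := fun _ => ℝ)
    (![f, g, h] : Fin 3 → ℝ → ℝ)
    (μ := fun i => volume.restrict ((![Ioi 1, Ioo 0 π, Ioo (-π) π] : Fin 3 → Set ℝ) i))
  simpa [Fin.prod_univ_three] using this

lemma prod_integrable {f g h : ℝ → ℝ} (hf : Integrable f (volume.restrict (Ioi 1)))
    (hg : Integrable g (volume.restrict (Ioo 0 π))) (hh : Integrable h (volume.restrict (Ioo (-π) π))) :
    Integrable (fun p : Fin 3 → ℝ => f (p 0) * g (p 1) * h (p 2)) (volume.restrict sphDom) := by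
  rw [restrict_sphDom]
  have hi : ∀ i : Fin 3, Integrable ((![f, g, h] : Fin 3 → ℝ → ℝ) i)
      (volume.restrict ((![Ioi 1, Ioo 0 π, Ioo (-π) π] : Fin 3 → Set ℝ) i)) := by
    intro i
    fin_cases i
    · exact hf
    · exact hg
    · exact hh
  have := Integrable.fintype_prod_dep hi
  simpa [Fin.prod_univ_three] using this

lemma cont_integrable {g : ℝ → ℝ} (hg : Continuous g) (a b : ℝ) :
    Integrable g (volume.restrict (Ioo a b)) :=
  (hg.integrableOn_Icc (a := a) (b := b)).mono_set Ioo_subset_Icc_self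

lemma main_nat (k m : ℕ) (hm : m ≤ k) :
    ∫ x in extB, qip (star (Xmon (-((k : ℤ) + 2)) m true x)) (Xmon (-((k : ℤ) + 2)) m true x) =
      1 / (2 * k + 1) * (π * (1 + if m = 0 then (1 : ℝ) else 0)) *
      (-(2 * (k + 1 + 2 * (m : ℝ) ^ 2) * (k + m).factorial) / ((2 * k + 3) * (k - m).factorial)) := by
  have hmeas : MeasurableSet sphDom := by
    refine MeasurableSet.univ_pi fun i => ?_
    fin_cases i
    · exact measurableSet_Ioi
    · exact measurableSet_Ioo
    · exact measurableSet_Ioo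
  rw [integral_ext, setIntegral_congr_fun hmeas (fun p hp => integrand_eq k m p hp)]
  have i1 := prod_integrable (radial_integrable k)
    (cont_integrable (g := fun θ => sin θ * (angG k m).eval (cos θ)) (by fun_prop) 0 π)
    (cont_integrable (g := fun φ => cos (m * φ) ^ 2) (by fun_prop) (-π) π)
  have i2 := prod_integrable (radial_integrable k)
    (cont_integrable (g := fun θ => sin θ * (angR k m).eval (cos θ)) (by fun_prop) 0 π)
    (cont_integrable (g := fun _ => 1) (by fun_prop) (-π) π)
  rw [integral_sub i1 i2, prod_integral (fun r => r⁻¹ ^ (2 * k + 2))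
      (fun θ => sin θ * (angG k m).eval (cos θ)) (fun φ => cos (m * φ) ^ 2),
    prod_integral (fun r => r⁻¹ ^ (2 * k + 2))
      (fun θ => sin θ * (angR k m).eval (cos θ)) (fun _ => 1),
    radial_integral, polar_integral, polar_integral, azimuth_integral, ← ang_total k m hm]
  have h1 : ∫ φ in Ioo (-π) π, (1 : ℝ) = 2 * π := by
    rw [← integral_Ioc_eq_integral_Ioo,
      ← intervalIntegral.integral_of_le (by linarith [Real.pi_pos])]
    simp; ring
  rw [h1]
  split_ifs with h
  · subst h
    have : pint (angR k 0) = 0 := by simp [angR, pint]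
    rw [this]; ring
  · ring

end FinalPart

/-- for `n ≤ -2`, `0 ≤ m ≤ -n-2`,
`⟨X̄_{n,m}^{+}, X_{n,m}^{+}⟩_{B^e}
  = 2π(n − 2m² + 1)(1 + δ_{0,m})(−(n−m+2))! / ((2n+3)(2n+1)(−(n+m+2))!)`. -/
theorem stmt13 (n : ℤ) (m : ℕ) (hn : n ≤ -2) (hm : (m : ℤ) ≤ -n - 2) :
    ∫ x in extB, qip (star (Xmon n m true x)) (Xmon n m true x) =
      2 * π * ((n - 2 * (m : ℤ) ^ 2 + 1 : ℤ) : ℝ) * (1 + if m = 0 then (1 : ℝ) else 0) *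
        ((-(n - (m : ℤ) + 2)).toNat.factorial : ℝ) /
        ((((2 * n + 3) * (2 * n + 1) : ℤ) : ℝ) * ((-(n + (m : ℤ) + 2)).toNat.factorial : ℝ)) := by
  obtain ⟨k, hk⟩ : ∃ k : ℕ, n = -((k : ℤ) + 2) := ⟨(-n - 2).toNat, by omega⟩
  subst hk
  have hmk : m ≤ k := by omega
  rw [main_nat k m hmk]
  have h1 : (-(-((k : ℤ) + 2) - (m : ℤ) + 2)).toNat = k + m := by omega
  have h2 : (-(-((k : ℤ) + 2) + (m : ℤ) + 2)).toNat = k - m := by omega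
  rw [h1, h2]
  push_cast
  have e1 : (2 * (-((k : ℝ) + 2)) + 3) * (2 * (-((k : ℝ) + 2)) + 1) = (2 * k + 1) * (2 * k + 3) := by
    ring
  rw [e1]
  have hf : ((k - m).factorial : ℝ) ≠ 0 := by positivity
  have h3 : (2 * (k : ℝ) + 3) ≠ 0 := by positivity
  have h4 : (2 * (k : ℝ) + 1) ≠ 0 := by positivity
  field_simp
  ring

end
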